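/- A priori bounds for blow-up solutions (power case): Let p > 1 and β := 2p/(p−1). There exist positive constants N₁, depending only on n, λ, Λ, K, p and diam Ω, and N₂, depending only on n, λ, Λ, K and p, such that every u ∈ C²(Ω) satisfying Lu(x) = (u(x))₊^p for all x ∈ Ω and u(x) → +∞ as d(x) → 0 obeys: (u(x))₊^p ≥ 1/N₁ for all x ∈ Ω, and (u(x))₊^p ≤ N₂ d(x)^{−β} for all x ∈ Δ₁ := {x ∈ Ω : d(x) < 1}. -/

import Mathlib

open Metric Set Filter Real Bornology

/-- First-order partial derivative `D_i u (x)`. -/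
noncomputable def pd {n : ℕ} (u : EuclideanSpace ℝ (Fin n) → ℝ) (i : Fin n)
    (x : EuclideanSpace ℝ (Fin n)) : ℝ :=
  fderiv ℝ u x (EuclideanSpace.single i 1)

/-- Second-order partial derivative `D_{ij} u (x)`. -/
noncomputable def pd2 {n : ℕ} (u : EuclideanSpace ℝ (Fin n) → ℝ) (i j : Fin n)
    (x : EuclideanSpace ℝ (Fin n)) : ℝ :=
  fderiv ℝ (fun y => fderiv ℝ u y (EuclideanSpace.single j 1)) x (EuclideanSpace.single i 1)

/-- The operator `L u = a^{ij} D_{ij} u + b^i D_i u - c u`. -/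
noncomputable def Lop {n : ℕ} (a : EuclideanSpace ℝ (Fin n) → Fin n → Fin n → ℝ)
    (b : EuclideanSpace ℝ (Fin n) → Fin n → ℝ) (c : EuclideanSpace ℝ (Fin n) → ℝ)
    (u : EuclideanSpace ℝ (Fin n) → ℝ) (x : EuclideanSpace ℝ (Fin n)) : ℝ :=
  (∑ i, ∑ j, a x i j * pd2 u i j x) + (∑ i, b x i * pd u i x) - c x * u x

/-- The standing assumptions on the coefficients of `L`: measurability, symmetry,
`Σ (b^i)² ≤ K`, `0 ≤ c ≤ K`, `K > 0`, and uniform ellipticity `λ|ξ|² ≤ aᵢⱼξᵢξⱼ ≤ Λ|ξ|²`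
with `0 < λ ≤ Λ`. -/
def CoeffsOK {n : ℕ} (a : EuclideanSpace ℝ (Fin n) → Fin n → Fin n → ℝ)
    (b : EuclideanSpace ℝ (Fin n) → Fin n → ℝ) (c : EuclideanSpace ℝ (Fin n) → ℝ)
    (K lam Lam : ℝ) : Prop :=
  (∀ i j, Measurable fun x => a x i j) ∧ (∀ i, Measurable fun x => b x i) ∧
  Measurable c ∧ (∀ x i j, a x i j = a x j i) ∧
  (∀ x, ∑ i, (b x i) ^ 2 ≤ K) ∧ (∀ x, 0 ≤ c x ∧ c x ≤ K) ∧
  0 < K ∧ 0 < lam ∧ lam ≤ Lam ∧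
  (∀ x (ξ : EuclideanSpace ℝ (Fin n)),
    lam * ‖ξ‖ ^ 2 ≤ ∑ i, ∑ j, a x i j * ξ i * ξ j ∧
    ∑ i, ∑ j, a x i j * ξ i * ξ j ≤ Lam * ‖ξ‖ ^ 2)

/-- `u(x) → +∞` as `d(x) := dist(x, ∂Ω) → 0`. -/
def BlowsUp {n : ℕ} (Ω : Set (EuclideanSpace ℝ (Fin n)))
    (u : EuclideanSpace ℝ (Fin n) → ℝ) : Prop :=
  ∀ M : ℝ, ∃ δ > 0, ∀ x ∈ Ω, infDist x (frontier Ω) < δ → M ≤ u x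


theorem sec_der_nonpos {n : ℕ} {f : EuclideanSpace ℝ (Fin n) → ℝ} {x : EuclideanSpace ℝ (Fin n)}
    (hf : ContDiffAt ℝ 2 f x) (hmax : IsLocalMax f x) (v : EuclideanSpace ℝ (Fin n)) :
    fderiv ℝ (fderiv ℝ f) x v v ≤ 0 := by
  have hd : DifferentiableAt ℝ (fderiv ℝ f) x :=
    (hf.fderiv_right (m := 1) (by norm_num)).differentiableAt (by norm_num)
  have hev : ∀ᶠ y in nhds x, DifferentiableAt ℝ f y := by
    filter_upwards [hf.eventually (by simp)] with y hy
    exact hy.differentiableAt (by norm_num)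
  have hl : ∀ t : ℝ, HasDerivAt (fun t : ℝ => x + t • v) v t := by
    intro t
    simpa using ((hasDerivAt_id t).smul_const v).const_add x
  have hc : Tendsto (fun t : ℝ => x + t • v) (nhds 0) (nhds x) := by
    have := (hl 0).continuousAt.tendsto
    simpa using this
  set g : ℝ → ℝ := fun t => f (x + t • v) with hg
  have hgd : ∀ᶠ t in nhds (0:ℝ), deriv g t = fderiv ℝ f (x + t • v) v := by
    filter_upwards [hc.eventually hev] with t ht
    exact (ht.hasFDerivAt.comp_hasDerivAt t (hl t)).deriv
  have h2 : deriv (deriv g) 0 = fderiv ℝ (fderiv ℝ f) x v v := by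
    rw [Filter.EventuallyEq.deriv_eq hgd]
    have e0 : x = x + (0:ℝ) • v := by simp
    have h1 : HasFDerivAt (fderiv ℝ f) (fderiv ℝ (fderiv ℝ f) x) (x + (0:ℝ) • v) := by
      rw [← e0]; exact hd.hasFDerivAt
    have h3 := h1.comp_hasDerivAt (0:ℝ) (hl 0)
    have h4 := h3.clm_apply (hasDerivAt_const (0:ℝ) v)
    simpa using h4.deriv
  have hgmax : IsLocalMax g 0 := by
    have : ∀ᶠ t in nhds (0:ℝ), f (x + t • v) ≤ f x := hc.eventually hmax
    filter_upwards [this] with t ht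
    simpa [hg] using ht
  by_contra hpos
  push Not at hpos
  rw [← h2] at hpos
  have hgc : ContinuousAt g 0 := by
    have : ContinuousAt f (x + (0:ℝ) • v) := by simpa using hf.continuousAt
    exact ContinuousAt.comp (f := fun t : ℝ => x + t • v) this (hl 0).continuousAt
  have hmin := isLocalMin_of_deriv_deriv_pos hpos hgmax.deriv_eq_zero hgc
  have hconst : g =ᶠ[nhds 0] fun _ => g 0 := by
    filter_upwards [hmin, hgmax] with t h1 h2
    exact le_antisymm h2 h1
  have hconst2 : deriv g =ᶠ[nhds 0] fun _ => 0 := by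
    filter_upwards [hconst.eventuallyEq_nhds] with t ht
    rw [ht.deriv_eq]; simp
  rw [hconst2.deriv_eq] at hpos
  simp at hpos

theorem pd2_eq {n : ℕ} {f : EuclideanSpace ℝ (Fin n) → ℝ} {x : EuclideanSpace ℝ (Fin n)}
    (hf : ContDiffAt ℝ 2 f x) (i j : Fin n) :
    pd2 f i j x = fderiv ℝ (fderiv ℝ f) x (EuclideanSpace.single i 1)
      (EuclideanSpace.single j 1) := by
  have hd : DifferentiableAt ℝ (fderiv ℝ f) x :=
    (hf.fderiv_right (m := 1) (by norm_num)).differentiableAt (by norm_num)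
  unfold pd2
  rw [fderiv_clm_apply hd (differentiableAt_const _)]
  simp

open scoped MatrixOrder Matrix.Norms.L2Operator in
theorem trace_nonpos {n : ℕ} {f : EuclideanSpace ℝ (Fin n) → ℝ} {x : EuclideanSpace ℝ (Fin n)}
    (hf : ContDiffAt ℝ 2 f x) (hmax : IsLocalMax f x) (a : Fin n → Fin n → ℝ)
    (hsymm : ∀ i j, a i j = a j i)
    (hpos : ∀ ξ : EuclideanSpace ℝ (Fin n), 0 ≤ ∑ i, ∑ j, a i j * ξ i * ξ j) :
    ∑ i, ∑ j, a i j * pd2 f i j x ≤ 0 := by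
  have hA : (Matrix.of a).PosSemidef := by
    refine Matrix.PosSemidef.of_dotProduct_mulVec_nonneg ?_ ?_
    · ext i j; simp [hsymm i j]
    · intro v
      have := hpos (WithLp.toLp 2 v)
      refine this.trans_eq ?_
      simp only [dotProduct, Matrix.mulVec, Finset.mul_sum]
      refine Finset.sum_congr rfl fun i _ => Finset.sum_congr rfl fun j _ => ?_
      simp; ring
  obtain ⟨B, hB⟩ := CStarAlgebra.nonneg_iff_eq_star_mul_self.mp hA.nonneg
  have hab : ∀ i j, a i j = ∑ k, B k i * B k j := by
    intro i j
    have := congrFun (congrFun hB i) j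
    simpa [Matrix.mul_apply] using this
  have key : ∑ i, ∑ j, a i j * pd2 f i j x = ∑ k, fderiv ℝ (fderiv ℝ f) x
      (∑ i, B k i • EuclideanSpace.single i (1:ℝ)) (∑ i, B k i • EuclideanSpace.single i (1:ℝ)) := by
    simp only [pd2_eq hf, hab, map_sum, map_smul, ContinuousLinearMap.sum_apply,
      ContinuousLinearMap.smul_apply, smul_eq_mul, Finset.sum_mul, Finset.mul_sum]
    rw [Finset.sum_comm]
    conv_rhs => rw [Finset.sum_comm]
    refine Finset.sum_congr rfl fun i _ => ?_
    rw [Finset.sum_comm]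
    refine Finset.sum_congr rfl fun j _ => Finset.sum_congr rfl fun k _ => ?_
    ring
  rw [key]
  exact Finset.sum_nonpos fun k _ => sec_der_nonpos hf hmax _

/-- Comparison at a touching point. -/
theorem compare_at {n : ℕ} {f g : EuclideanSpace ℝ (Fin n) → ℝ} {x : EuclideanSpace ℝ (Fin n)}
    (hf : ContDiffAt ℝ 2 f x) (hg : ContDiffAt ℝ 2 g x)
    (hmax : IsLocalMax (fun y => f y - g y) x) (a : Fin n → Fin n → ℝ) (b : Fin n → ℝ)
    (hsymm : ∀ i j, a i j = a j i)
    (hpos : ∀ ξ : EuclideanSpace ℝ (Fin n), 0 ≤ ∑ i, ∑ j, a i j * ξ i * ξ j) :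
    (∑ i, ∑ j, a i j * pd2 f i j x) + ∑ i, b i * pd f i x ≤
      (∑ i, ∑ j, a i j * pd2 g i j x) + ∑ i, b i * pd g i x := by
  have h1 := trace_nonpos (hf.sub hg) hmax a hsymm hpos
  have h0 := hmax.fderiv_eq_zero
  have hfd := hf.differentiableAt (by norm_num)
  have hgd := hg.differentiableAt (by norm_num)
  have hp : ∀ i, pd f i x = pd g i x := by
    intro i
    rw [fderiv_fun_sub hfd hgd, sub_eq_zero] at h0
    simp [pd, h0]
  have hd : ∀ {f : EuclideanSpace ℝ (Fin n) → ℝ}, ContDiffAt ℝ 2 f x →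
      DifferentiableAt ℝ (fderiv ℝ f) x := fun hf =>
    (hf.fderiv_right (m := 1) (by norm_num)).differentiableAt (by norm_num)
  have hev : ∀ {f : EuclideanSpace ℝ (Fin n) → ℝ}, ContDiffAt ℝ 2 f x →
      ∀ᶠ y in nhds x, DifferentiableAt ℝ f y := by
    intro f hf
    filter_upwards [hf.eventually (by simp)] with y hy
    exact hy.differentiableAt (by norm_num)
  have hF : fderiv ℝ (fun y => f y - g y) =ᶠ[nhds x] fun y => fderiv ℝ f y - fderiv ℝ g y := by
    filter_upwards [hev hf, hev hg] with y h1 h2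
    exact fderiv_fun_sub h1 h2
  have h2 : ∀ i j, pd2 (fun y => f y - g y) i j x = pd2 f i j x - pd2 g i j x := by
    intro i j
    rw [pd2_eq hf, pd2_eq hg, pd2_eq (hf.sub hg), hF.fderiv_eq, fderiv_fun_sub (hd hf) (hd hg)]
    simp
  have h1' : ∑ i, ∑ j, a i j * pd2 (fun y => f y - g y) i j x ≤ 0 := h1
  simp only [h2, mul_sub, Finset.sum_sub_distrib] at h1'
  simp only [hp]
  linarith

/-- Chain rule for `φ ∘ q`. -/
theorem pd_comp {n : ℕ} {q : EuclideanSpace ℝ (Fin n) → ℝ} {x : EuclideanSpace ℝ (Fin n)}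
    {φ : ℝ → ℝ} {φ' : ℝ} (hq : DifferentiableAt ℝ q x) (hφ : HasDerivAt φ φ' (q x)) (i : Fin n) :
    pd (fun y => φ (q y)) i x = φ' * pd q i x := by
  have := hφ.comp_hasFDerivAt x hq.hasFDerivAt
  unfold pd
  have h2 : fderiv ℝ (fun y => φ (q y)) x = φ' • fderiv ℝ q x := this.fderiv
  rw [h2]; simp

theorem pd2_comp {n : ℕ} {q : EuclideanSpace ℝ (Fin n) → ℝ} {x : EuclideanSpace ℝ (Fin n)}
    {φ φ' : ℝ → ℝ} {φ'' : ℝ} (hq : ContDiff ℝ 2 q)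
    (hφ : ∀ᶠ t in nhds (q x), HasDerivAt φ (φ' t) t) (hφ' : HasDerivAt φ' φ'' (q x))
    (i j : Fin n) :
    pd2 (fun y => φ (q y)) i j x = φ'' * pd q i x * pd q j x + φ' (q x) * pd2 q i j x := by
  have hqd : Differentiable ℝ q := hq.differentiable (by norm_num)
  have hev : (fun y => pd (fun y => φ (q y)) j y) =ᶠ[nhds x] fun y => φ' (q y) * pd q j y := by
    filter_upwards [(hqd x).continuousAt.eventually hφ] with y hy
    exact pd_comp (hqd y) hy j
  have hpdd : DifferentiableAt ℝ (fun y => pd q j y) x := by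
    have hd : DifferentiableAt ℝ (fderiv ℝ q) x :=
      ((hq.contDiffAt (x := x)).fderiv_right (m := 1) (by norm_num)).differentiableAt (by norm_num)
    exact hd.clm_apply (differentiableAt_const _)
  have h1 := (hφ'.comp_hasFDerivAt x (hqd x).hasFDerivAt).mul hpdd.hasFDerivAt
  have h2 : fderiv ℝ (fun y => φ' (q y) * pd q j y) x = _ := h1.fderiv
  have h3 : pd2 (fun y => φ (q y)) i j x
      = fderiv ℝ (fun y => pd (fun y => φ (q y)) j y) x (EuclideanSpace.single i 1) := rfl
  rw [h3, hev.fderiv_eq, h2]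
  have h4 : pd2 q i j x = fderiv ℝ (fun y => pd q j y) x (EuclideanSpace.single i 1) := rfl
  rw [h4]
  simp [pd]
  ring

theorem pd_coord {n : ℕ} (k : Fin n) (α s : ℝ) (x : EuclideanSpace ℝ (Fin n)) (i : Fin n) :
    pd (fun y : EuclideanSpace ℝ (Fin n) => α * (y k - s)) i x = if i = k then α else 0 := by
  have h : HasFDerivAt (fun y : EuclideanSpace ℝ (Fin n) => α * (y k - s))
      (α • (EuclideanSpace.proj k : EuclideanSpace ℝ (Fin n) →L[ℝ] ℝ)) x := by
    have := ((EuclideanSpace.proj k : EuclideanSpace ℝ (Fin n) →L[ℝ] ℝ).hasFDerivAt (x := x))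
    exact (this.sub_const s).const_mul α
  unfold pd
  rw [h.fderiv]
  by_cases hik : i = k
  · subst hik; simp
  · simp [hik, Ne.symm hik]

theorem pd2_coord {n : ℕ} (k : Fin n) (α s : ℝ) (x : EuclideanSpace ℝ (Fin n)) (i j : Fin n) :
    pd2 (fun y : EuclideanSpace ℝ (Fin n) => α * (y k - s)) i j x = 0 := by
  have h3 : pd2 (fun y : EuclideanSpace ℝ (Fin n) => α * (y k - s)) i j x
      = fderiv ℝ (fun y => pd (fun y : EuclideanSpace ℝ (Fin n) => α * (y k - s)) j y) x
        (EuclideanSpace.single i 1) := rfl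
  rw [h3]
  simp only [pd_coord]
  simp

theorem pd_quad {n : ℕ} (x0 : EuclideanSpace ℝ (Fin n)) (s : ℝ) (x : EuclideanSpace ℝ (Fin n))
    (i : Fin n) :
    pd (fun y : EuclideanSpace ℝ (Fin n) => s - ‖y - x0‖ ^ 2) i x = -2 * (x i - x0 i) := by
  have h := (((hasFDerivAt_id x).sub_const x0).norm_sq).const_sub s
  unfold pd
  have h2 : fderiv ℝ (fun y : EuclideanSpace ℝ (Fin n) => s - ‖y - x0‖ ^ 2) x = _ := h.fderiv
  rw [h2]
  simp [EuclideanSpace.inner_single_right]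

theorem pd2_quad {n : ℕ} (x0 : EuclideanSpace ℝ (Fin n)) (s : ℝ) (x : EuclideanSpace ℝ (Fin n))
    (i j : Fin n) :
    pd2 (fun y : EuclideanSpace ℝ (Fin n) => s - ‖y - x0‖ ^ 2) i j x = if i = j then -2 else 0 := by
  have h3 : pd2 (fun y : EuclideanSpace ℝ (Fin n) => s - ‖y - x0‖ ^ 2) i j x
      = fderiv ℝ (fun y => pd (fun y : EuclideanSpace ℝ (Fin n) => s - ‖y - x0‖ ^ 2) j y) x
        (EuclideanSpace.single i 1) := rfl
  rw [h3]
  simp only [pd_quad]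
  have h : (fun y : EuclideanSpace ℝ (Fin n) => -2 * (y j - x0 j)) =
    (fun y : EuclideanSpace ℝ (Fin n) => (-2) * (y j - x0 j)) := rfl
  have := pd_coord j (-2) (x0 j) x i
  unfold pd at this
  exact this

theorem ball_subset_of_frontier {n : ℕ} {Ω : Set (EuclideanSpace ℝ (Fin n))} (ho : IsOpen Ω)
    {x : EuclideanSpace ℝ (Fin n)} (hx : x ∈ Ω) :
    ball x (infDist x (frontier Ω)) ⊆ Ω := by
  have hpc : IsPreconnected (ball x (infDist x (frontier Ω))) := (convex_ball _ _).isPreconnected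
  rcases (ball x (infDist x (frontier Ω))).eq_empty_or_nonempty with he | hne
  · rw [he]; exact empty_subset _
  have hr : 0 < infDist x (frontier Ω) := nonempty_ball.1 hne
  refine hpc.subset_left_of_subset_union ho (isClosed_closure (s := Ω)).isOpen_compl ?_ ?_ ?_
  · exact disjoint_compl_right_iff_subset.2 subset_closure
  · intro y hy
    by_cases hyc : y ∈ closure Ω
    · left
      by_contra hyo
      have hyf : y ∈ frontier Ω := by rw [ho.frontier_eq]; exact ⟨hyc, hyo⟩
      have := infDist_le_dist_of_mem (x := x) hyf
      rw [mem_ball, dist_comm] at hy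
      linarith
    · right; exact hyc
  · exact ⟨x, mem_ball_self hr, hx⟩

theorem lower_bound {n : ℕ} (k : Fin n) {K lam Lam p : ℝ} (hp : 1 < p)
    {Ω : Set (EuclideanSpace ℝ (Fin n))} (ho : IsOpen Ω) (hbd : IsBounded Ω)
    {a : EuclideanSpace ℝ (Fin n) → Fin n → Fin n → ℝ}
    {b : EuclideanSpace ℝ (Fin n) → Fin n → ℝ}
    {c : EuclideanSpace ℝ (Fin n) → ℝ} (hco : CoeffsOK a b c K lam Lam)
    {u : EuclideanSpace ℝ (Fin n) → ℝ} (hu : ContDiffOn ℝ 2 u Ω)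
    (heq : ∀ x ∈ Ω, Lop a b c u x = (max (u x) 0) ^ p) (hbl : BlowsUp Ω u)
    {y : EuclideanSpace ℝ (Fin n)} (hy : y ∈ Ω) :
    exp (-((1 + 2 * (K + 1) / lam) * diam Ω)) ≤ u y := by
  obtain ⟨-, -, -, hsymm, hb, hc, hK, hlam, hlL, hell⟩ := hco
  set α : ℝ := 1 + 2 * (K + 1) / lam with hα
  have hα1 : 1 ≤ α := by rw [hα]; have : 0 ≤ 2 * (K + 1) / lam := by positivity
                         linarith
  have hαl : 2 * (K + 1) ≤ lam * α := by
    have : lam * α = lam + 2 * (K + 1) := by rw [hα]; field_simp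
    linarith
  set s : ℝ := y k + diam Ω with hs
  set q : EuclideanSpace ℝ (Fin n) → ℝ := fun x => α * (x k - s) with hq
  by_contra hlt
  push Not at hlt
  have hqy : q y = -(α * diam Ω) := by simp only [hq, hs]; ring
  have hq0 : ∀ x ∈ Ω, q x ≤ 0 := by
    intro x hx
    have h1 : |x k - y k| ≤ dist x y := by
      rw [EuclideanSpace.dist_eq]
      apply Real.le_sqrt_of_sq_le
      have := Finset.single_le_sum (f := fun i => dist (x i) (y i) ^ 2)
        (fun i _ => sq_nonneg _) (Finset.mem_univ k)
      simpa [Real.dist_eq] using this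
    have h2 := dist_le_diam_of_mem hbd hx hy
    have h3 := le_abs_self (x k - y k)
    have : x k - s ≤ 0 := by simp only [hs]; linarith
    exact mul_nonpos_of_nonneg_of_nonpos (by linarith) this
  rw [← hqy] at hlt
  obtain ⟨δ, hδ, hM⟩ := hbl 1
  set S := closure Ω ∩ {x | δ ≤ infDist x (frontier Ω)} with hS
  have hScomp : IsCompact S :=
    hbd.isCompact_closure.inter_right (isClosed_le continuous_const (continuous_infDist_pt _))
  have hSΩ : S ⊆ Ω := by
    rintro x ⟨hx1, hx2⟩
    by_contra hxo
    have hxf : x ∈ frontier Ω := by rw [ho.frontier_eq]; exact ⟨hx1, hxo⟩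
    have := infDist_zero_of_mem hxf
    simp only [mem_setOf_eq] at hx2
    linarith
  have hout : ∀ x ∈ Ω, x ∉ S → exp (q x) ≤ u x := by
    intro x hx hxS
    have : infDist x (frontier Ω) < δ := by
      by_contra h
      exact hxS ⟨subset_closure hx, not_lt.1 h⟩
    exact (exp_le_one_iff.2 (hq0 x hx)).trans (hM x hx this)
  have hyS : y ∈ S := by
    by_contra h
    linarith [hout y hy h]
  have hqc : ContDiff ℝ 2 q := by
    have : ContDiff ℝ 2 (fun x : EuclideanSpace ℝ (Fin n) => x k) :=
      (EuclideanSpace.proj k : EuclideanSpace ℝ (Fin n) →L[ℝ] ℝ).contDiff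
    exact contDiff_const.mul (this.sub contDiff_const)
  have hwc : ContDiff ℝ 2 (fun x => exp (q x)) := hqc.exp
  obtain ⟨z, hzS, hz⟩ := hScomp.exists_isMaxOn ⟨y, hyS⟩
    (f := fun x => exp (q x) - u x) (hwc.continuous.continuousOn.sub (hu.continuousOn.mono hSΩ))
  have hzΩ := hSΩ hzS
  have hzpos : 0 < exp (q z) - u z := by
    have : exp (q y) - u y ≤ exp (q z) - u z := hz hyS
    linarith
  have hmax : IsLocalMax (fun x => exp (q x) - u x) z := by
    filter_upwards [ho.mem_nhds hzΩ] with x hx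
    by_cases hxS : x ∈ S
    · exact hz hxS
    · linarith [hout x hx hxS]
  have hcmp := compare_at hwc.contDiffAt (hu.contDiffAt (ho.mem_nhds hzΩ)) hmax (a z) (b z)
    (hsymm z) (fun ξ => le_trans (by positivity) (hell z ξ).1)
  have hLu := heq z hzΩ
  unfold Lop at hLu
  have e1 : ∀ i, pd (fun x => exp (q x)) i z = exp (q z) * (if i = k then α else 0) := by
    intro i
    rw [pd_comp (hqc.differentiable (by norm_num) z) (Real.hasDerivAt_exp _), hq, pd_coord]
  have e2 : ∀ i j, pd2 (fun x => exp (q x)) i j z =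
      exp (q z) * (if i = k then α else 0) * (if j = k then α else 0) := by
    intro i j
    rw [pd2_comp (φ' := exp) hqc (Eventually.of_forall fun t => Real.hasDerivAt_exp t)
      (Real.hasDerivAt_exp _), hq, pd2_coord, pd_coord, pd_coord]
    ring
  have s1 : ∑ i, ∑ j, a z i j * pd2 (fun x => exp (q x)) i j z = exp (q z) * (a z k k * α ^ 2) := by
    simp only [e2]
    simp
    ring
  have s2 : ∑ i, b z i * pd (fun x => exp (q x)) i z = exp (q z) * (b z k * α) := by
    simp only [e1]
    simp
    ring
  have hakk : lam ≤ a z k k := by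
    have := (hell z (EuclideanSpace.single k 1)).1
    simpa using this
  have hbk : -(K + 1) ≤ b z k := by
    have := Finset.single_le_sum (f := fun i => b z i ^ 2)
        (fun i _ => sq_nonneg _) (Finset.mem_univ k)
    have h2 := hb z
    nlinarith [sq_nonneg (b z k + 1)]
  have hmain : K + 1 ≤ a z k k * α ^ 2 + b z k * α := by
    have h1 : lam * α ^ 2 ≤ a z k k * α ^ 2 := by gcongr
    have h2 : -(K + 1) * α ≤ b z k * α := by gcongr
    nlinarith
  rw [s1, s2] at hcmp
  set w := exp (q z) with hw
  have hwpos : 0 < w := exp_pos _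
  have hw1 : w ≤ 1 := exp_le_one_iff.2 (hq0 z hzΩ)
  have h3 : w * (K + 1) ≤ w * (a z k k * α ^ 2) + w * (b z k * α) := by
    rw [← mul_add]; gcongr
  have h4 : c z * u z ≤ w * K := by
    have := hc z
    have h5 : c z * u z ≤ c z * w := mul_le_mul_of_nonneg_left (by linarith) this.1
    nlinarith
  have h6 : w ≤ max (u z) 0 ^ p := by linarith
  have h7 : max (u z) 0 ^ p < w ^ p :=
    Real.rpow_lt_rpow (le_max_right _ _) (max_lt (by linarith) hwpos) (by linarith)
  have h8 : w ^ p ≤ w := by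
    have := Real.rpow_le_rpow_of_exponent_ge hwpos hw1 hp.le
    simpa using this
  linarith

set_option maxHeartbeats 1600000 in
theorem upper_bound {n : ℕ} {K lam Lam p : ℝ} (hp : 1 < p)
    {Ω : Set (EuclideanSpace ℝ (Fin n))} (ho : IsOpen Ω)
    {a : EuclideanSpace ℝ (Fin n) → Fin n → Fin n → ℝ}
    {b : EuclideanSpace ℝ (Fin n) → Fin n → ℝ}
    {c : EuclideanSpace ℝ (Fin n) → ℝ} (hco : CoeffsOK a b c K lam Lam)
    {u : EuclideanSpace ℝ (Fin n) → ℝ} (hu : ContDiffOn ℝ 2 u Ω)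
    (heq : ∀ x ∈ Ω, Lop a b c u x = (max (u x) 0) ^ p)
    {x0 : EuclideanSpace ℝ (Fin n)} {ρ γ : ℝ} (hρ : 0 < ρ) (hρ1 : ρ ≤ 1)
    (hγ : γ = 2 / (p - 1)) (hsub : closedBall x0 ρ ⊆ Ω) (hu0 : 0 < u x0) :
    u x0 ^ (p - 1) * ρ ^ 2 ≤ 4 * γ * (γ + 1) * Lam + 2 * γ * (n * Lam) + γ * (K + 1) := by
  obtain ⟨-, -, -, hsymm, hb, hc, hK, hlam, hlL, hell⟩ := hco
  have hp1 : 0 < p - 1 := by linarith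
  have hγ0 : 0 < γ := by rw [hγ]; positivity
  have hγp : γ * (p - 1) = 2 := by rw [hγ]; field_simp
  set q : EuclideanSpace ℝ (Fin n) → ℝ := fun x => ρ ^ 2 - ‖x - x0‖ ^ 2 with hq
  have hqc : ContDiff ℝ 2 q := contDiff_const.sub ((contDiff_id.sub contDiff_const).norm_sq ℝ)
  obtain ⟨z, hzS, hz⟩ := (isCompact_closedBall x0 ρ).exists_isMaxOn ⟨x0, mem_closedBall_self hρ.le⟩
    (f := fun x => u x * q x ^ γ) ((hu.continuousOn.mono hsub).mul
      (hqc.continuous.continuousOn.rpow_const fun x _ => Or.inr hγ0.le))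
  have hq0 : q x0 = ρ ^ 2 := by simp [hq]
  have hM : u x0 * (ρ ^ 2) ^ γ ≤ u z * q z ^ γ := by
    have := hz (mem_closedBall_self hρ.le)
    simpa [hq0] using this
  have hMpos : 0 < u z * q z ^ γ := lt_of_lt_of_le (by positivity) hM
  have hqz0 : 0 ≤ q z := by
    rw [mem_closedBall, dist_eq_norm] at hzS
    simp only [hq]
    nlinarith [norm_nonneg (z - x0)]
  have hqz : 0 < q z := by
    rcases hqz0.eq_or_lt with h | h
    · rw [← h, Real.zero_rpow hγ0.ne'] at hMpos
      simp at hMpos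
    · exact h
  have huz : 0 < u z := pos_of_mul_pos_left hMpos (by positivity)
  have hzΩ := hsub hzS
  set M := u z * q z ^ γ with hMdef
  have hv_z : M * q z ^ (-γ) = u z := by
    rw [hMdef, mul_assoc, ← Real.rpow_add hqz]; simp
  have hvc : ContDiffAt ℝ 2 (fun x => M * q x ^ (-γ)) z :=
    contDiffAt_const.mul (hqc.contDiffAt.rpow_const_of_ne hqz.ne')
  have hmax : IsLocalMax (fun x => u x - M * q x ^ (-γ)) z := by
    have hev : ∀ᶠ x in nhds z, 0 < q x :=
      hqc.continuous.continuousAt.eventually (lt_mem_nhds hqz)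
    filter_upwards [hev] with x hx
    rw [hv_z, sub_self]
    have hxb : x ∈ closedBall x0 ρ := by
      rw [mem_closedBall, dist_eq_norm]
      simp only [hq] at hx
      exact abs_le_of_sq_le_sq' (by linarith) hρ.le |>.2
    have h1 : u x * q x ^ γ ≤ M := hz hxb
    have h2 : u x = u x * q x ^ γ * q x ^ (-γ) := by
      rw [mul_assoc, ← Real.rpow_add hx]; simp
    have h3 : u x * q x ^ γ * q x ^ (-γ) ≤ M * q x ^ (-γ) := by gcongr
    linarith
  have hcmp := compare_at (hu.contDiffAt (ho.mem_nhds hzΩ)) hvc hmax (a z) (b z)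
    (hsymm z) (fun ξ => le_trans (by positivity) (hell z ξ).1)
  have hLu := heq z hzΩ
  unfold Lop at hLu
  set h := q z with hh
  set U := u z with hU
  have d1 : ∀ t : ℝ, 0 < t → HasDerivAt (fun t : ℝ => M * t ^ (-γ)) (M * (-γ * t ^ (-γ - 1))) t :=
    fun t ht => (Real.hasDerivAt_rpow_const (Or.inl ht.ne')).const_mul M
  have d2 : HasDerivAt (fun t : ℝ => M * (-γ * t ^ (-γ - 1)))
      (M * (-γ * ((-γ - 1) * h ^ (-γ - 1 - 1)))) h :=
    ((Real.hasDerivAt_rpow_const (Or.inl hqz.ne')).const_mul (-γ)).const_mul M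
  have r1 : M * (-γ * h ^ (-γ - 1)) = -γ * (U / h) := by
    rw [Real.rpow_sub_one hqz.ne', ← hv_z]; ring
  have r2 : M * (-γ * ((-γ - 1) * h ^ (-γ - 1 - 1))) = γ * (γ + 1) * (U / h ^ 2) := by
    rw [Real.rpow_sub_one hqz.ne', Real.rpow_sub_one hqz.ne', ← hv_z]; field_simp; ring
  have e1 : ∀ i, pd (fun x => M * q x ^ (-γ)) i z = 2 * γ * (U / h) * (z i - x0 i) := by
    intro i
    rw [pd_comp (φ := fun t : ℝ => M * t ^ (-γ)) (hqc.differentiable (by norm_num) z) (d1 h hqz),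
      r1, hq, pd_quad]
    ring
  have e2 : ∀ i j, pd2 (fun x => M * q x ^ (-γ)) i j z =
      4 * γ * (γ + 1) * (U / h ^ 2) * ((z i - x0 i) * (z j - x0 j))
        + 2 * γ * (U / h) * (if i = j then 1 else 0) := by
    intro i j
    rw [pd2_comp (φ := fun t : ℝ => M * t ^ (-γ)) hqc
      (by filter_upwards [lt_mem_nhds hqz] with t ht using d1 t ht) d2]
    rw [r2, ← hh, r1, hq, pd2_quad, pd_quad, pd_quad]
    split_ifs <;> ring
  have s1 : ∑ i, ∑ j, a z i j * pd2 (fun x => M * q x ^ (-γ)) i j z =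
      4 * γ * (γ + 1) * (U / h ^ 2) * (∑ i, ∑ j, a z i j * (z - x0) i * (z - x0) j)
       + 2 * γ * (U / h) * ∑ i, a z i i := by
    simp only [e2, mul_add, Finset.sum_add_distrib, Finset.mul_sum]
    congr 1
    · refine Finset.sum_congr rfl fun i _ => Finset.sum_congr rfl fun j _ => ?_
      simp; ring
    · refine Finset.sum_congr rfl fun i _ => ?_
      simp; ring
  have s2 : ∑ i, b z i * pd (fun x => M * q x ^ (-γ)) i z =
      2 * γ * (U / h) * ∑ i, b z i * (z - x0) i := by
    simp only [e1, Finset.mul_sum]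
    refine Finset.sum_congr rfl fun i _ => ?_
    simp; ring
  have t1 : ∑ i, a z i i ≤ n * Lam := by
    have : ∀ i ∈ Finset.univ, a z i i ≤ Lam := by
      intro i _
      have := (hell z (EuclideanSpace.single i 1)).2
      simpa using this
    simpa using Finset.sum_le_sum this
  have hnρ : ‖z - x0‖ ^ 2 ≤ ρ ^ 2 := by simp only [hh, hq] at hqz; linarith
  have hhρ : h ≤ ρ ^ 2 := by simp only [hh, hq]; nlinarith [sq_nonneg ‖z - x0‖]
  have hLam : 0 < Lam := by linarith
  have t2 : ∑ i, ∑ j, a z i j * (z - x0) i * (z - x0) j ≤ Lam * ρ ^ 2 :=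
    (hell z (z - x0)).2.trans (by gcongr)
  have t3 : ∑ i, b z i * (z - x0) i ≤ (K + 1) / 2 := by
    have h1 : ∑ i, b z i * (z - x0) i ≤ ∑ i, (b z i ^ 2 + (z - x0) i ^ 2) / 2 := by
      refine Finset.sum_le_sum fun i _ => ?_
      nlinarith [sq_nonneg (b z i - (z - x0) i)]
    have h2 : ∑ i, (z - x0) i ^ 2 = ‖z - x0‖ ^ 2 := by
      rw [EuclideanSpace.real_norm_sq_eq]
    rw [← Finset.sum_div, Finset.sum_add_distrib, h2] at h1
    have := hb z
    nlinarith
  rw [s1, s2] at hcmp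
  have hUp : U ^ p ≤ 4 * γ * (γ + 1) * (U / h ^ 2) * (Lam * ρ ^ 2)
      + 2 * γ * (U / h) * (n * Lam) + 2 * γ * (U / h) * ((K + 1) / 2) := by
    have h1 : 0 ≤ c z * U := mul_nonneg (hc z).1 huz.le
    rw [max_eq_left huz.le] at hLu
    have g1 := mul_le_mul_of_nonneg_left t2 (show 0 ≤ 4 * γ * (γ + 1) * (U / h ^ 2) by positivity)
    have g2 := mul_le_mul_of_nonneg_left t1 (show 0 ≤ 2 * γ * (U / h) by positivity)
    have g3 := mul_le_mul_of_nonneg_left t3 (show 0 ≤ 2 * γ * (U / h) by positivity)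
    linarith
  set C := 4 * γ * (γ + 1) * Lam + 2 * γ * (n * Lam) + γ * (K + 1) with hC
  have hUp1 : U ^ (p - 1) * h ^ 2 ≤ C * ρ ^ 2 := by
    have e : U ^ p = U ^ (p - 1) * U := by
      rw [← Real.rpow_add_one huz.ne']; simp
    have h1 : U ^ (p - 1) * U * h ^ 2 ≤ U * (4 * γ * (γ + 1) * Lam * ρ ^ 2
        + 2 * γ * (n * Lam) * h + γ * (K + 1) * h) := by
      rw [e] at hUp
      have := mul_le_mul_of_nonneg_right hUp (sq_nonneg h)
      refine this.trans_eq ?_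
      field_simp
    have h2 : U ^ (p - 1) * h ^ 2 ≤ 4 * γ * (γ + 1) * Lam * ρ ^ 2
        + 2 * γ * (n * Lam) * h + γ * (K + 1) * h := by
      refine le_of_mul_le_mul_left ?_ huz
      linarith
    have g2 := mul_le_mul_of_nonneg_left hhρ (show 0 ≤ 2 * γ * (n * Lam) by positivity)
    have g3 := mul_le_mul_of_nonneg_left hhρ (show 0 ≤ γ * (K + 1) by positivity)
    rw [hC]; linarith
  have hpow : ∀ s t : ℝ, 0 < s → 0 < t → (s * t ^ γ) ^ (p - 1) = s ^ (p - 1) * t ^ 2 := by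
    intro s t hs ht
    rw [Real.mul_rpow hs.le (by positivity), ← Real.rpow_mul ht.le, hγp]
    norm_num
  have hfin := Real.rpow_le_rpow (by positivity) hM hp1.le
  rw [hpow _ _ hu0 (by positivity), hMdef, hpow _ _ huz hqz] at hfin
  have hρ2 : 0 < ρ ^ 2 := by positivity
  refine le_of_mul_le_mul_right ?_ hρ2
  calc u x0 ^ (p - 1) * ρ ^ 2 * ρ ^ 2 = u x0 ^ (p - 1) * (ρ ^ 2) ^ 2 := by ring
    _ ≤ _ := hfin.trans hUp1

/-- Lemma 4.3 of the paper, power case. There are constants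
`N₂ > 0` depending only on `n, λ, Λ, K, p`, and `N₁ > 0` depending in addition
on `diam Ω` (formalized as a positive function of the diameter), such that any
blow-up solution `u` of `Lu = u₊^p` satisfies `u₊^p ≥ 1/N₁` in `Ω` and
`u₊^p ≤ N₂ d^{-β}` in `Δ₁ = {x ∈ Ω : d(x) < 1}`, where `β = 2p/(p-1)`. -/
theorem a_priori_bounds_power {n : ℕ} (hn : 2 ≤ n)
    (K lam Lam : ℝ) (hK : 0 < K) (hlam : 0 < lam) (hlL : lam ≤ Lam)
    (p : ℝ) (hp : 1 < p) :
    ∃ N₂ : ℝ, 0 < N₂ ∧ ∃ N₁ : ℝ → ℝ, (∀ D : ℝ, 0 < N₁ D) ∧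
      ∀ (Ω : Set (EuclideanSpace ℝ (Fin n))),
        IsOpen Ω → IsConnected Ω → IsBounded Ω →
      ∀ (a : EuclideanSpace ℝ (Fin n) → Fin n → Fin n → ℝ)
        (b : EuclideanSpace ℝ (Fin n) → Fin n → ℝ)
        (c : EuclideanSpace ℝ (Fin n) → ℝ), CoeffsOK a b c K lam Lam →
      ∀ u : EuclideanSpace ℝ (Fin n) → ℝ, ContDiffOn ℝ 2 u Ω →
        (∀ x ∈ Ω, Lop a b c u x = (max (u x) 0) ^ p) → BlowsUp Ω u →
        (∀ x ∈ Ω, 1 / N₁ (diam Ω) ≤ (max (u x) 0) ^ p) ∧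
        (∀ x ∈ Ω, infDist x (frontier Ω) < 1 →
          (max (u x) 0) ^ p ≤ N₂ / infDist x (frontier Ω) ^ (2 * p / (p - 1))) := by
  set γ : ℝ := 2 / (p - 1) with hγ
  have hp1 : 0 < p - 1 := by linarith
  have hγ0 : 0 < γ := by positivity
  have hLam : 0 < Lam := by linarith
  set C := 4 * γ * (γ + 1) * Lam + 2 * γ * (n * Lam) + γ * (K + 1) with hC
  have hC0 : 0 < C := by positivity
  refine ⟨(4 * C) ^ (p / (p - 1)), by positivity,
    fun D => exp ((1 + 2 * (K + 1) / lam) * D * p), fun D => exp_pos _, ?_⟩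
  intro Ω ho _ hbd a b c hco u hu heq hbl
  refine ⟨fun x hx => ?_, fun x hx hx1 => ?_⟩
  · have h1 := lower_bound (k := ⟨0, by omega⟩) hp ho hbd hco hu heq hbl hx
    have h2 := Real.rpow_le_rpow (exp_pos _).le (h1.trans (le_max_left _ 0)) (by linarith : 0 ≤ p)
    refine le_trans (le_of_eq ?_) h2
    rw [← Real.exp_mul, one_div, ← Real.exp_neg]
    congr 1; ring
  · set r := infDist x (frontier Ω) with hr
    have hr0 : 0 < r := by
      rcases (infDist_nonneg (x := x) (s := frontier Ω)).eq_or_lt with h | h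
      · obtain ⟨δ, hδ, h2⟩ := hbl (u x + 1)
        have := h2 x hx (by rw [← h]; exact hδ)
        linarith
      · exact h
    rcases le_or_gt (u x) 0 with hu0 | hu0
    · rw [max_eq_right hu0, Real.zero_rpow (by linarith)]
      positivity
    rw [max_eq_left hu0.le]
    have hsub : closedBall x (r / 2) ⊆ Ω :=
      (closedBall_subset_ball (by linarith)).trans (ball_subset_of_frontier ho hx)
    have h1 := upper_bound hp ho hco hu heq (by positivity) (by linarith) hγ hsub hu0
    have h2 : u x ^ (p - 1) ≤ 4 * C / r ^ 2 := by
      rw [le_div_iff₀ (by positivity)]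
      linarith
    have h3 := Real.rpow_le_rpow (by positivity) h2 (show 0 ≤ p / (p - 1) by positivity)
    rw [← Real.rpow_mul hu0.le, mul_div_cancel₀ _ hp1.ne', Real.div_rpow (by positivity)
      (by positivity), ← Real.rpow_natCast, ← Real.rpow_mul hr0.le] at h3
    convert h3 using 3
    push_cast; ring
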